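/- arXiv:1606.01364 — 6 statements merged into one kernel-verified Lean document; each statement's English description precedes it below -/
import Mathlib

section
/- (Theorem 3, lower bound on the number of symbols.) Let ε > 0 and let L ≥ 1 be a real number, and suppose M = ((1 + 2ε²)^{L−1} − 1)(1 + ε²)/(2ε²). Then L ≥ 1/2 + ln((2M + 1)ε² + 1)/(2ε²). -/
/-- The optimal estimation function with real argument:
`A_ε(x) = ((1+2ε²)^x − 1)(1+ε²)/(2ε²)` (using the real power `rpow`). -/
noncomputable def A (ε x : ℝ) : ℝ :=
  ((1 + 2 * ε ^ 2) ^ x - 1) / (2 * ε ^ 2) * (1 + ε ^ 2)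

/-- The logarithm of the affine function of `A ε x` in the symbol-count bound splits. -/
lemma log_two_mul_A_add_one (ε x : ℝ) (hε : 0 < ε) :
    Real.log ((2 * A ε x + 1) * ε ^ 2 + 1) =
      x * Real.log (1 + 2 * ε ^ 2) + Real.log (1 + ε ^ 2) := by
  have h : (2 * A ε x + 1) * ε ^ 2 + 1 = (1 + 2 * ε ^ 2) ^ x * (1 + ε ^ 2) := by
    unfold A
    field_simp
    ring
  rw [h, Real.log_mul (by positivity) (by positivity), Real.log_rpow (by positivity)]

/-- Theorem 3, lower bound on the number of symbols: if `ε > 0`,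
`L ≥ 1` and `M = A_ε(L−1)`, then `L ≥ 1/2 + ln((2M+1)ε² + 1)/(2ε²)`. -/
theorem symbol_count_lower_bound (ε L M : ℝ) (hε : 0 < ε) (hL : 1 ≤ L)
    (hM : M = A ε (L - 1)) :
    L ≥ 1 / 2 + Real.log ((2 * M + 1) * ε ^ 2 + 1) / (2 * ε ^ 2) := by
  rw [hM, log_two_mul_A_add_one ε _ hε]
  have h₁ : Real.log (1 + 2 * ε ^ 2) ≤ 2 * ε ^ 2 := by
    linarith [Real.log_le_sub_one_of_pos (show 0 < 1 + 2 * ε ^ 2 by positivity)]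
  have h₂ : Real.log (1 + ε ^ 2) ≤ ε ^ 2 := by
    linarith [Real.log_le_sub_one_of_pos (show 0 < 1 + ε ^ 2 by positivity)]
  have h₃ := mul_le_mul_of_nonneg_left h₁ (sub_nonneg.2 hL)
  have h₄ : ((L - 1) * Real.log (1 + 2 * ε ^ 2) + Real.log (1 + ε ^ 2)) / (2 * ε ^ 2) ≤
      L - 1 / 2 := by
    rw [div_le_iff₀ (by positivity)]
    linarith
  linarith
end

section
/- (Theorem 3, tight upper bound on the number of symbols.) Let ε > 0 and let L ≥ 1 be a real number, and suppose M = ((1 + 2ε²)^{L−1} − 1)(1 + ε²)/(2ε²). Then L < 1/2 + (1 + 2ε²)·ln((2M + 1)ε² + 1)/(2ε²). -/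
/-- Theorem 3, tight upper bound on the number of symbols: if
`ε > 0`, `L ≥ 1` and `M = A_ε(L−1)`, then
`L < 1/2 + (1+2ε²)·ln((2M+1)ε² + 1)/(2ε²)`. -/
theorem symbol_count_tight_upper_bound (ε L M : ℝ) (hε : 0 < ε) (hL : 1 ≤ L)
    (hM : M = A ε (L - 1)) :
    L < 1 / 2 + (1 + 2 * ε ^ 2) * Real.log ((2 * M + 1) * ε ^ 2 + 1) /
      (2 * ε ^ 2) := by
  obtain ⟨s, hs⟩ : ∃ s, s = ε ^ 2 := ⟨_, rfl⟩
  have hs0 : 0 < s := hs ▸ pow_pos hε 2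
  have hpow : 0 < (1 + 2 * s) ^ (L - 1) := Real.rpow_pos_of_pos (by linarith) _
  have harg : (2 * M + 1) * s + 1 = (1 + 2 * s) ^ (L - 1) * (1 + s) := by
    rw [hM, A, ← hs]
    field_simp
    ring
  rw [← hs, harg, Real.log_mul hpow.ne' (by linarith), Real.log_rpow (by linarith)]
  have hlog₁ : 2 * s ≤ (1 + 2 * s) * Real.log (1 + 2 * s) := by
    have h := Real.one_sub_inv_le_log_of_pos (x := 1 + 2 * s) (by linarith)
    calc 2 * s = (1 + 2 * s) * (1 - (1 + 2 * s)⁻¹) := by field_simp; ring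
      _ ≤ _ := by gcongr
  have hlog₂ : s < (1 + 2 * s) * Real.log (1 + s) := by
    have h := Real.one_sub_inv_le_log_of_pos (x := 1 + s) (by linarith)
    have hlog : 0 < Real.log (1 + s) := Real.log_pos (by linarith)
    calc s = (1 + s) * (1 - (1 + s)⁻¹) := by field_simp; ring
      _ ≤ (1 + s) * Real.log (1 + s) := by gcongr
      _ < _ := by gcongr; linarith
  rw [← sub_lt_iff_lt_add', lt_div_iff₀ (by linarith)]
  linarith [mul_le_mul_of_nonneg_left hlog₁ (sub_nonneg.2 hL)]
end

section
/- (Theorem 3, simplified upper bound on the number of symbols.) Let 0 < ε < 1 and let L ≥ 2 be a real number, and suppose M = ((1 + 2ε²)^{L−1} − 1)(1 + ε²)/(2ε²). Then L < 2·ln((2M + 1)ε² + 1)/ε². -/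
theorem le_log_one_add_of_mul_le {a x : ℝ} (hx : 0 < 1 + x) (h : a * (1 + x) ≤ x) :
    a ≤ Real.log (1 + x) := by
  refine le_trans ?_ (Real.one_sub_inv_le_log_of_pos hx)
  have : 1 - (1 + x)⁻¹ = x / (1 + x) := by field_simp; ring
  rwa [this, le_div_iff₀ hx]

/-- The argument of the logarithm in the bound, for `M = A ε x`, as a product. -/
theorem two_mul_A_add_one_mul_sq_add_one {ε : ℝ} (hε : ε ≠ 0) (x : ℝ) :
    (2 * A ε x + 1) * ε ^ 2 + 1 = (1 + 2 * ε ^ 2) ^ x * (1 + ε ^ 2) := by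
  unfold A
  field_simp
  ring

/-- Theorem 3, simplified upper bound on the number of symbols:
if `0 < ε < 1`, `L ≥ 2` and `M = A_ε(L−1)`, then
`L < 2·ln((2M+1)ε² + 1)/ε²`. -/
theorem symbol_count_upper_bound (ε L M : ℝ) (hε : 0 < ε) (hε1 : ε < 1)
    (hL : 2 ≤ L) (hM : M = A ε (L - 1)) :
    L < 2 * Real.log ((2 * M + 1) * ε ^ 2 + 1) / ε ^ 2 := by
  have ht : 0 < ε ^ 2 := by positivity
  have ht1 : ε ^ 2 < 1 := by nlinarith
  rw [hM, two_mul_A_add_one_mul_sq_add_one hε.ne', Real.log_mul (by positivity) (by positivity),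
    Real.log_rpow (by positivity), lt_div_iff₀ ht]
  have h₁ : 2 * ε ^ 2 / 3 ≤ Real.log (1 + 2 * ε ^ 2) :=
    le_log_one_add_of_mul_le (by positivity) (by nlinarith)
  have h₂ : ε ^ 2 / 2 ≤ Real.log (1 + ε ^ 2) :=
    le_log_one_add_of_mul_le (by positivity) (by nlinarith)
  have h₃ : (L - 1) * (2 * ε ^ 2 / 3) ≤ (L - 1) * Real.log (1 + 2 * ε ^ 2) :=
    mul_le_mul_of_nonneg_left h₁ (by linarith)
  nlinarith
end

section
/- (Claim: upper bound on the error needed for capacity M.) Let L ≥ 2 be an integer and let M be a real number with 6M/(L−1) > 1. Define ε > 0 by ε² = 3·ln(6M/(L−1))/(L−1), and assume ε < 1. Then A_ε(L−1) > M, i.e., the error parameter √(3·ln(6M/(L−1))/(L−1)) already suffices for counting capacity M. -/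
theorem exp_le_one_add_two_mul {x : ℝ} (h0 : 0 ≤ x) (h1 : x ≤ 1) :
    Real.exp x ≤ 1 + 2 * x := by
  have h := (abs_le.mp (Real.abs_exp_sub_one_sub_id_le (abs_le.mpr ⟨by linarith, h1⟩))).2
  nlinarith

theorem mul_exp_lt_exp_three_mul_sub_one {t : ℝ} (ht : 0 < t) :
    t * Real.exp t < Real.exp (3 * t) - 1 := by
  have h1 : 1 < Real.exp t := Real.one_lt_exp_iff.mpr ht
  have h2 : 2 * t + 1 ≤ Real.exp (2 * t) := Real.add_one_le_exp (2 * t)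
  have h3 : Real.exp (3 * t) = Real.exp t * Real.exp (2 * t) := by
    rw [← Real.exp_add]; ring_nf
  rw [h3]
  nlinarith [mul_le_mul_of_nonneg_left h2 (Real.exp_pos t).le, mul_pos ht (Real.exp_pos t)]

/-- Claim: upper bound on the error needed for capacity `M`:
for an integer `L ≥ 2` and a real `M` with `6M/(L−1) > 1`, the error
parameter `ε` with `ε² = 3·ln(6M/(L−1))/(L−1)` (assumed `< 1`) satisfies
`A_ε(L−1) > M`, i.e. it already suffices for counting capacity `M`. -/
theorem error_upper_bound_suffices (L : ℕ) (hL : 2 ≤ L) (M ε : ℝ)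
    (hM : 6 * M / ((L : ℝ) - 1) > 1) (hε : 0 < ε)
    (hεsq : ε ^ 2 = 3 * Real.log (6 * M / ((L : ℝ) - 1)) / ((L : ℝ) - 1))
    (hε1 : ε < 1) :
    A ε ((L : ℝ) - 1) > M := by
  have hL' : (2 : ℝ) ≤ L := by exact_mod_cast hL
  have hn : 0 < (L : ℝ) - 1 := by linarith
  have he : 0 < ε ^ 2 := by positivity
  have he1 : ε ^ 2 ≤ 1 := by nlinarith
  unfold A
  generalize (L : ℝ) - 1 = n at *
  generalize ε ^ 2 = e at *
  have hexp : Real.exp (n * e / 3) = 6 * M / n := by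
    rw [hεsq, show n * (3 * Real.log (6 * M / n) / n) / 3 = Real.log (6 * M / n) by field_simp,
      Real.exp_log (by linarith)]
  have hMe : M = n * Real.exp (n * e / 3) / 6 := by
    rw [hexp]; field_simp
  have hpow : Real.exp (3 * (n * e / 3)) ≤ (1 + 2 * e) ^ n := by
    rw [show 3 * (n * e / 3) = e * n by ring, Real.exp_mul]
    exact Real.rpow_le_rpow (Real.exp_pos e).le (exp_le_one_add_two_mul he.le he1) hn.le
  have hkey := mul_exp_lt_exp_three_mul_sub_one (t := n * e / 3) (by positivity)
  have hlt : M < ((1 + 2 * e) ^ n - 1) / (2 * e) := by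
    rw [lt_div_iff₀ (by positivity), hMe]
    linarith
  have hM0 : 0 < M := by rw [hMe]; positivity
  nlinarith [mul_pos (hM0.trans hlt) he]
end

section
/- (Claim: lower bound on the error needed for capacity M.) Let L ≥ 2 be an integer and let M be a real number with M > L−1 (so (2M+1)/(2L−1) > 1). Define ε > 0 by ε² = ln((2M+1)/(2L−1))/(2(L−1)). Then A_ε(L−1) ≤ M, i.e., the error parameter √(ln((2M+1)/(2L−1))/(2(L−1))) achieves a counting capacity of at most M. -/
/-- Claim: lower bound on the error needed for capacity `M`:
for an integer `L ≥ 2` and a real `M > L−1`, the error parameter `ε` with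
`ε² = ln((2M+1)/(2L−1))/(2(L−1))` satisfies `A_ε(L−1) ≤ M`, i.e. it achieves
a counting capacity of at most `M`. -/
theorem error_lower_bound_insufficient (L : ℕ) (hL : 2 ≤ L) (M ε : ℝ)
    (hM : M > (L : ℝ) - 1) (hε : 0 < ε)
    (hεsq : ε ^ 2 =
      Real.log ((2 * M + 1) / (2 * (L : ℝ) - 1)) / (2 * ((L : ℝ) - 1))) :
    A ε ((L : ℝ) - 1) ≤ M := by
  have hL' : (2 : ℝ) ≤ L := by exact_mod_cast hL
  have hu : 0 < 2 * ε ^ 2 := by positivity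
  unfold A
  set n : ℝ := (L : ℝ) - 1 with hn
  set u : ℝ := 2 * ε ^ 2 with hu_def
  have hn1 : 1 ≤ n := by linarith
  have hquot : 0 < (2 * M + 1) / (2 * (L : ℝ) - 1) := by
    apply div_pos <;> linarith
  have hlog : u * n = Real.log ((2 * M + 1) / (2 * (L : ℝ) - 1)) := by
    rw [hu_def, hεsq]
    field_simp
  have hexp : Real.exp (u * n) * (2 * n + 1) = 2 * M + 1 := by
    rw [hlog, Real.exp_log hquot, show 2 * n + 1 = 2 * (L : ℝ) - 1 by rw [hn]; ring]
    exact div_mul_cancel₀ _ (by linarith)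
  have hpow : (1 + u) ^ n ≤ Real.exp (u * n) := by
    rw [Real.exp_mul]
    exact Real.rpow_le_rpow (by linarith) (by linarith [Real.add_one_le_exp u]) (by linarith)
  have htangent : Real.exp (u * n) - 1 ≤ n * Real.exp (u * n) * u := by
    have h := mul_le_mul_of_nonneg_right (Real.add_one_le_exp (-(u * n)))
      (Real.exp_pos (u * n)).le
    rw [← Real.exp_add, neg_add_cancel, Real.exp_zero] at h
    linarith
  have hslope : ((1 + u) ^ n - 1) / u ≤ n * Real.exp (u * n) := by
    rw [div_le_iff₀ hu]
    linarith
  have hsplit : ((1 + u) ^ n - 1) / u * (1 + ε ^ 2)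
      = ((1 + u) ^ n - 1) / u + ((1 + u) ^ n - 1) / 2 := by
    rw [show ε ^ 2 = u / 2 by rw [hu_def]; ring]
    field_simp
  rw [hsplit]
  linarith
end

section
/- (Existence of the exact error parameter between the two bounds.) Let L ≥ 2 be an integer and let M be a real number with M > L−1, 6M/(L−1) > 1, and 3·ln(6M/(L−1))/(L−1) < 1. Then there exists ε > 0 with ln((2M+1)/(2L−1))/(2(L−1)) ≤ ε² ≤ 3·ln(6M/(L−1))/(L−1) such that A_ε(L−1) = M. -/
/-- If `u` is the logarithmic lower bound, then the capacity at squared error `u` is at most `M`. -/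
lemma capacity_le_of_lower_bound {n : ℕ} (hn : 0 < n) {M u : ℝ} (hM : (n : ℝ) < M)
    (hu : u = Real.log ((2 * M + 1) / (2 * n + 1)) / (2 * n)) :
    0 < u ∧ ((1 + 2 * u) ^ n - 1) / (2 * u) * (1 + u) ≤ M := by
  have hn' : (0 : ℝ) < n := by exact_mod_cast hn
  have hM0 : 0 < M := hn'.trans hM
  have hK : 0 < (2 * M + 1) / (2 * n + 1) := by positivity
  have hlog : 2 * n * u = Real.log ((2 * M + 1) / (2 * n + 1)) := by
    rw [hu]; field_simp
  have hlower : (M - n) / (n * (2 * M + 1)) ≤ u := by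
    have h := Real.one_sub_inv_le_log_of_pos hK
    rw [← hlog, inv_div] at h
    have h2 : 1 - (2 * n + 1) / (2 * M + 1) = 2 * n * ((M - n) / (n * (2 * M + 1))) := by
      field_simp
      ring
    rw [h2] at h
    exact le_of_mul_le_mul_left h (by positivity)
  have hu0 : 0 < u := lt_of_lt_of_le (div_pos (by linarith) (by positivity)) hlower
  refine ⟨hu0, ?_⟩
  have hpow : (1 + 2 * u) ^ n ≤ (2 * M + 1) / (2 * n + 1) := by
    calc (1 + 2 * u) ^ n ≤ Real.exp (2 * u) ^ n := by
          gcongr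
          linarith [Real.add_one_le_exp (2 * u)]
      _ = (2 * M + 1) / (2 * n + 1) := by
          rw [← Real.exp_nat_mul, show (n : ℝ) * (2 * u) = 2 * n * u by ring, hlog,
            Real.exp_log hK]
  rw [div_le_iff₀ (by positivity)] at hlower
  rw [div_mul_eq_mul_div, div_le_iff₀ (by positivity)]
  calc ((1 + 2 * u) ^ n - 1) * (1 + u)
      ≤ ((2 * M + 1) / (2 * n + 1) - 1) * (1 + u) := by gcongr
    _ = 2 * (M - n) * (1 + u) / (2 * n + 1) := by field_simp; ring
    _ ≤ M * (2 * u) := by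
      rw [div_le_iff₀ (by positivity)]
      linarith

/-- If `u < 1` is the logarithmic upper bound, then the capacity at squared error `u` is at
least `M`. -/
lemma le_capacity_of_upper_bound {n : ℕ} (hn : 0 < n) {M u : ℝ} (hM : (n : ℝ) < M)
    (hu : u = 3 * Real.log (6 * M / n) / n) (hu1 : u < 1) :
    M ≤ ((1 + 2 * u) ^ n - 1) / (2 * u) * (1 + u) := by
  have hn' : (0 : ℝ) < n := by exact_mod_cast hn
  obtain ⟨R, hR⟩ : ∃ R, R = 6 * M / n := ⟨_, rfl⟩
  rw [← hR] at hu
  have hMR : 6 * M = R * n := by rw [hR]; field_simp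
  have hR1 : 1 < R := by
    rw [hR, lt_div_iff₀ hn']; linarith
  have hlog : 0 < Real.log R := Real.log_pos hR1
  have hu0 : 0 < u := by rw [hu]; positivity
  have hnu : n * u = 3 * Real.log R := by rw [hu]; field_simp
  have hexp : Real.exp u ≤ 1 + 2 * u := by
    have h := (abs_le.mp (Real.abs_exp_sub_one_sub_id_le (abs_le.mpr ⟨by linarith, hu1.le⟩))).2
    nlinarith
  have hpow : R ^ 3 ≤ (1 + 2 * u) ^ n := by
    calc R ^ 3 = Real.exp u ^ n := by
          rw [← Real.exp_nat_mul, hnu, mul_comm, Real.exp_mul,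
            Real.exp_log (by linarith)]
          norm_cast
      _ ≤ (1 + 2 * u) ^ n := by gcongr
  have hRlog : R * Real.log R ≤ R ^ 3 - 1 := by
    have h := Real.log_le_sub_one_of_pos (show 0 < R by linarith)
    nlinarith [mul_pos (show 0 < R by linarith) (show 0 < R by linarith)]
  have hMu : M * (2 * u) = R * Real.log R := by
    linear_combination (u / 3) * hMR + (R / 3) * hnu
  rw [div_mul_eq_mul_div, le_div_iff₀ (by positivity), hMu]
  have h1 : 0 ≤ (1 + 2 * u) ^ n - 1 := by nlinarith
  nlinarith

/-- Existence of the exact error parameter between the two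
bounds: for an integer `L ≥ 2` and a real `M` with `M > L−1`,
`6M/(L−1) > 1` and `3·ln(6M/(L−1))/(L−1) < 1`, there exists `ε > 0` with
`ln((2M+1)/(2L−1))/(2(L−1)) ≤ ε² ≤ 3·ln(6M/(L−1))/(L−1)` and
`A_ε(L−1) = M`. -/
theorem exists_exact_error (L : ℕ) (hL : 2 ≤ L) (M : ℝ)
    (hM : M > (L : ℝ) - 1) (hM6 : 6 * M / ((L : ℝ) - 1) > 1)
    (hsmall : 3 * Real.log (6 * M / ((L : ℝ) - 1)) / ((L : ℝ) - 1) < 1) :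
    ∃ ε : ℝ, 0 < ε ∧
      Real.log ((2 * M + 1) / (2 * (L : ℝ) - 1)) / (2 * ((L : ℝ) - 1)) ≤ ε ^ 2 ∧
      ε ^ 2 ≤ 3 * Real.log (6 * M / ((L : ℝ) - 1)) / ((L : ℝ) - 1) ∧
      A ε ((L : ℝ) - 1) = M := by
  obtain ⟨n, rfl⟩ : ∃ n, L = n + 1 := ⟨L - 1, by omega⟩
  have hn : 0 < n := by omega
  have hn' : (0 : ℝ) < n := by exact_mod_cast hn
  have hsub : ((n + 1 : ℕ) : ℝ) - 1 = n := by push_cast; ring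
  have hden : 2 * ((n + 1 : ℕ) : ℝ) - 1 = 2 * n + 1 := by push_cast; ring
  rw [hsub] at hM hM6 hsmall ⊢
  rw [hden]
  obtain ⟨a, ha⟩ : ∃ a, a = Real.log ((2 * M + 1) / (2 * n + 1)) / (2 * n) := ⟨_, rfl⟩
  obtain ⟨b, hb⟩ : ∃ b, b = 3 * Real.log (6 * M / n) / n := ⟨_, rfl⟩
  rw [← hb] at hsmall
  obtain ⟨ha0, hfa⟩ := capacity_le_of_lower_bound hn hM ha
  have hfb := le_capacity_of_upper_bound hn hM hb hsmall
  have hM0 : 0 < M := hn'.trans hM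
  have hab : a ≤ b := by
    have hle : Real.log ((2 * M + 1) / (2 * n + 1)) ≤ Real.log (6 * M / n) := by
      apply Real.log_le_log (by positivity)
      rw [div_le_div_iff₀ (by positivity) hn']
      nlinarith [mul_pos hM0 hn']
    have hpos := Real.log_pos hM6
    rw [ha, hb, div_le_div_iff₀ (by positivity) hn']
    nlinarith [mul_pos hpos hn']
  have hcont : ContinuousOn (fun u : ℝ => ((1 + 2 * u) ^ n - 1) / (2 * u) * (1 + u))
      (Set.Icc a b) := by
    refine ContinuousOn.mul (ContinuousOn.div (by fun_prop) (by fun_prop) ?_) (by fun_prop)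
    intro u hu
    have := ha0.trans_le hu.1
    positivity
  obtain ⟨u, ⟨hau, hub⟩, hfu⟩ := intermediate_value_Icc hab hcont ⟨hfa, hfb⟩
  have hu0 : 0 < u := ha0.trans_le hau
  refine ⟨√u, Real.sqrt_pos.mpr hu0, ?_⟩
  rw [A, Real.sq_sqrt hu0.le, Real.rpow_natCast, ← ha, ← hb]
  exact ⟨hau, hub, hfu⟩
end
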